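/- arXiv:1606.05417 — 2 statements merged into one kernel-verified Lean document; each statement's English description precedes it below -/
import Mathlib

section
/- There do not exist a real number c₂ ≠ 0 and a function b : ℝ → ℝ such that b(z)·c₂²/2 = φ₃(z) and b(z)·c₂³/6 = φ₄(z) hold for all z ∈ ℝ. Equivalently, there is no real constant λ with φ₄(z) = λ·φ₃(z) for all z ∈ ℝ. -/
/-- For `k ≥ 1`, `φ_k(z) = ∫₀¹ e^{(1-θ)z} θ^{k-1}/(k-1)! dθ`. -/
noncomputable def phi (k : ℕ) (z : ℝ) : ℝ :=
  ∫ θ in (0:ℝ)..1, Real.exp ((1 - θ) * z) * θ ^ (k - 1) / (Nat.factorial (k - 1))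

lemma phi_three_zero : phi 3 0 = 1 / 6 := by
  norm_num [phi, Nat.factorial]

lemma phi_four_zero : phi 4 0 = 1 / 24 := by
  norm_num [phi, Nat.factorial]

lemma phi_three_one : phi 3 1 = Real.exp 1 - 5 / 2 := by
  have h (x : ℝ) : HasDerivAt (fun θ : ℝ ↦ -(Real.exp (1 - θ) * (θ ^ 2 / 2 + θ + 1)))
      (Real.exp ((1 - x) * 1) * x ^ (3 - 1) / (Nat.factorial (3 - 1))) x := by
    have he := ((hasDerivAt_id x).const_sub 1).exp
    have hp := (((hasDerivAt_pow 2 x).div_const 2).add (hasDerivAt_id x)).add_const 1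
    refine (he.mul hp).neg.congr_deriv ?_
    norm_num [Nat.factorial]
    ring
  rw [phi, intervalIntegral.integral_eq_sub_of_hasDerivAt (fun x _ ↦ h x)
    (Continuous.intervalIntegrable (by fun_prop) _ _)]
  norm_num
  ring

lemma phi_four_one : phi 4 1 = Real.exp 1 - 8 / 3 := by
  have h (x : ℝ) : HasDerivAt (fun θ : ℝ ↦ -(Real.exp (1 - θ) * (θ ^ 3 / 6 + θ ^ 2 / 2 + θ + 1)))
      (Real.exp ((1 - x) * 1) * x ^ (4 - 1) / (Nat.factorial (4 - 1))) x := by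
    have he := ((hasDerivAt_id x).const_sub 1).exp
    have hp := ((((hasDerivAt_pow 3 x).div_const 6).add
      ((hasDerivAt_pow 2 x).div_const 2)).add (hasDerivAt_id x)).add_const 1
    refine (he.mul hp).neg.congr_deriv ?_
    norm_num [Nat.factorial]
    ring
  rw [phi, intervalIntegral.integral_eq_sub_of_hasDerivAt (fun x _ ↦ h x)
    (Continuous.intervalIntegrable (by fun_prop) _ _)]
  norm_num
  ring

lemma phi_four_ne_const_mul_phi_three : ¬ ∃ lam : ℝ, ∀ z : ℝ, phi 4 z = lam * phi 3 z := by
  rintro ⟨lam, h⟩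
  have h0 := h 0
  have h1 := h 1
  rw [phi_four_zero, phi_three_zero] at h0
  obtain rfl : lam = 1 / 4 := by linarith
  rw [phi_four_one, phi_three_one] at h1
  linarith [Real.exp_one_lt_d9]

/-- The exact stiff order conditions `b(z)c₂²/2 = φ₃(z)`, `b(z)c₂³/6 = φ₄(z)` for a
two-stage exponential Rosenbrock method of order four are unsolvable; equivalently,
`φ₄` is not a constant multiple of `φ₃`. -/
theorem stiff_order_conditions_unsolvable :
    (¬ ∃ (c₂ : ℝ) (b : ℝ → ℝ), c₂ ≠ 0 ∧
      ∀ z : ℝ, b z * c₂ ^ 2 / 2 = phi 3 z ∧ b z * c₂ ^ 3 / 6 = phi 4 z) ∧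
    (¬ ∃ lam : ℝ, ∀ z : ℝ, phi 4 z = lam * phi 3 z) := by
  refine ⟨?_, phi_four_ne_const_mul_phi_three⟩
  rintro ⟨c₂, b, -, h⟩
  refine phi_four_ne_const_mul_phi_three ⟨c₂ / 3, fun z ↦ ?_⟩
  rw [← (h z).1, ← (h z).2]
  ring
end

section
/- Let c₂ be a nonzero real number and b : ℝ → ℝ a function such that b(z)·c₂² = 2·φ₃(z) for all z ∈ ℝ and b(0)·c₂³ = 6·φ₄(0). Then necessarily c₂ = 3/4 and b(z) = (32/9)·φ₃(z) for all z ∈ ℝ; i.e., the relaxed stiff order conditions for a fourth-order two-stage exponential Rosenbrock method have this unique solution. -/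
theorem phi_succ_zero (k : ℕ) : phi (k + 1) 0 = 1 / (k + 1).factorial := by
  simp only [phi, mul_zero, Real.exp_zero, one_mul, Nat.add_sub_cancel,
    intervalIntegral.integral_div, integral_pow, one_pow, Nat.factorial_succ]
  push_cast
  have h : (k.factorial : ℝ) ≠ 0 := Nat.cast_ne_zero.mpr k.factorial_ne_zero
  field_simp
  simp

/-- The relaxed stiff order conditions `b(z)c₂² = 2φ₃(z)` (for all `z`) and
`b(0)c₂³ = 6φ₄(0)` have the unique solution `c₂ = 3/4`, `b = (32/9)φ₃`. -/
theorem relaxed_stiff_order_conditions_unique (c₂ : ℝ) (hc : c₂ ≠ 0) (b : ℝ → ℝ)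
    (h1 : ∀ z : ℝ, b z * c₂ ^ 2 = 2 * phi 3 z)
    (h2 : b 0 * c₂ ^ 3 = 6 * phi 4 0) :
    c₂ = 3 / 4 ∧ ∀ z : ℝ, b z = (32 / 9) * phi 3 z := by
  have h3 : phi 3 0 = 1 / 6 := (phi_succ_zero 2).trans (by norm_num [Nat.factorial])
  have h4 : phi 4 0 = 1 / 24 := (phi_succ_zero 3).trans (by norm_num [Nat.factorial])
  have hb := h1 0
  rw [h3] at hb
  rw [h4] at h2
  have hc₂ : c₂ = 3 / 4 := by linear_combination 3 * h2 - 3 * c₂ * hb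
  refine ⟨hc₂, fun z => ?_⟩
  have hz := h1 z
  rw [hc₂] at hz
  linarith
end
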